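/- arXiv:2504.19677 — 3 statements merged into one kernel-verified Lean document; each statement's English description precedes it below -/
import Mathlib

section
/- Let d ≥ 1, ε > 0, let Y ⊆ ℝ^d_{≥0} be nonempty, let V ⊆ Y be finite nonempty, and set 𝒜 := conv(V) + ℝ^d_{≥0}. Suppose there is a finite family of pairs (w_j, c_j) ∈ ℝ^d × ℝ, j ∈ J, such that 𝒜 = ⋂_{j ∈ J} {z ∈ ℝ^d : ⟨w_j, z⟩ ≥ c_j} (an H-representation of 𝒜). If (1+ε)⟨w_j, y⟩ ≥ c_j for all j ∈ J and all y ∈ Y, then: (a) V is a (1+ε)-convex approximation set for Y, i.e., for every y ∈ Y there exists v ∈ conv(V) with v ≤ (1+ε)y; and (b) Y⁺_{1+ε} ⊆ 𝒜 ⊆ Y⁺. -/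
open Pointwise

/-- Correctness of the inner approximation algorithm: if `𝒜 = conv(V) + ℝ^d_{≥0}`
has an H-representation by halfspaces `⟨w_j,z⟩ ≥ c_j`, and every `(1+ε)`-scaled image satisfies
all these inequalities, then `V` is a `(1+ε)`-convex approximation set and
`Y⁺_{1+ε} ⊆ 𝒜 ⊆ Y⁺`. -/
theorem stmt_6 (d : ℕ) (hd : 1 ≤ d) (ε : ℝ) (hε : 0 < ε)
    (Y : Set (Fin d → ℝ)) (hY : Y.Nonempty) (hYpos : ∀ y ∈ Y, (0 : Fin d → ℝ) ≤ y)
    (V : Set (Fin d → ℝ)) (hVY : V ⊆ Y) (hVfin : V.Finite) (hVne : V.Nonempty)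
    (J : Type) [Fintype J] (w : J → Fin d → ℝ) (c : J → ℝ)
    (hH : convexHull ℝ V + {z : Fin d → ℝ | 0 ≤ z} =
      ⋂ j : J, {z : Fin d → ℝ | c j ≤ ∑ i, w j i * z i})
    (horacle : ∀ j : J, ∀ y ∈ Y, c j ≤ (1 + ε) * ∑ i, w j i * y i) :
    (∀ y ∈ Y, ∃ v ∈ convexHull ℝ V, v ≤ (1 + ε) • y) ∧
    ((fun v : Fin d → ℝ => (1 + ε) • v) ''
        (convexHull ℝ Y + {z : Fin d → ℝ | 0 ≤ z}) ⊆
      convexHull ℝ V + {z : Fin d → ℝ | 0 ≤ z}) ∧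
    (convexHull ℝ V + {z : Fin d → ℝ | 0 ≤ z} ⊆
      convexHull ℝ Y + {z : Fin d → ℝ | 0 ≤ z}) := by
  have hscaled : ∀ y ∈ Y, (1 + ε) • y ∈ convexHull ℝ V + {z : Fin d → ℝ | 0 ≤ z} := by
    intro y hy
    rw [hH, Set.mem_iInter]
    intro j
    simpa [Finset.mul_sum, mul_left_comm] using horacle j y hy
  have hconvex : Convex ℝ (convexHull ℝ V + {z : Fin d → ℝ | 0 ≤ z}) :=
    (convex_convexHull ℝ V).add (convex_Ici 0)
  refine ⟨fun y hy => ?_, ?_, Set.add_subset_add_right (convexHull_mono hVY)⟩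
  · obtain ⟨v, hv, z, hz, hvz⟩ := Set.mem_add.mp (hscaled y hy)
    exact ⟨v, hv, hvz ▸ le_add_of_nonneg_right hz⟩
  · rintro _ ⟨_, ⟨u, hu, z, hz, rfl⟩, rfl⟩
    have hu' : (1 + ε) • u ∈ convexHull ℝ V + {z : Fin d → ℝ | 0 ≤ z} :=
      convexHull_min (t := (fun x : Fin d → ℝ => (1 + ε) • x) ⁻¹' _) hscaled
        (hconvex.smul_preimage (1 + ε)) hu
    obtain ⟨v, hv, p, hp, hvp⟩ := Set.mem_add.mp hu'
    have hz' : 0 ≤ (1 + ε) • z := smul_nonneg (by linarith) hz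
    exact ⟨v, hv, p + (1 + ε) • z, add_nonneg hp hz', by simp only [smul_add, ← hvp, add_assoc]⟩
end

section
/- Let d ≥ 1, ε > 0, α ≥ 1, let Y ⊆ ℝ^d_{≥0} be nonempty, let V ⊆ Y be finite nonempty, and set 𝒜 := conv(V) + ℝ^d_{≥0}. Suppose there is a finite family of pairs (w_j, c_j) ∈ ℝ^d × ℝ, j ∈ J, such that 𝒜 = ⋂_{j ∈ J} {z ∈ ℝ^d : ⟨w_j, z⟩ ≥ c_j}, and suppose that for each j ∈ J there exists a point y*_j ∈ ℝ^d with (1+ε)⟨w_j, y*_j⟩ ≥ c_j and ⟨w_j, y*_j⟩ ≤ α⟨w_j, y⟩ for all y ∈ Y. Then for every y ∈ Y the point α(1+ε)y lies in 𝒜; in particular, for every y ∈ Y there exists v ∈ conv(V) with v ≤ α(1+ε)y, i.e., V is an α(1+ε)-convex approximation set for Y. -/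
open Pointwise

/-- Approximation guarantee with an `α`-approximate weighted sum oracle:
if for each halfspace `⟨w_j,z⟩ ≥ c_j` of the H-representation of `𝒜 = conv(V) + ℝ^d_{≥0}`
there is a point `y*_j` with `(1+ε)⟨w_j,y*_j⟩ ≥ c_j` that `α`-approximately minimizes
`⟨w_j,·⟩` over `Y`, then `α(1+ε)y ∈ 𝒜` for every `y ∈ Y`; in particular `V` is an
`α(1+ε)`-convex approximation set. -/
theorem stmt_7 (d : ℕ) (hd : 1 ≤ d) (ε : ℝ) (hε : 0 < ε) (α : ℝ) (hα : 1 ≤ α)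
    (Y : Set (Fin d → ℝ)) (hY : Y.Nonempty) (hYpos : ∀ y ∈ Y, (0 : Fin d → ℝ) ≤ y)
    (V : Set (Fin d → ℝ)) (hVY : V ⊆ Y) (hVfin : V.Finite) (hVne : V.Nonempty)
    (J : Type) [Fintype J] (w : J → Fin d → ℝ) (c : J → ℝ)
    (hH : convexHull ℝ V + {z : Fin d → ℝ | 0 ≤ z} =
      ⋂ j : J, {z : Fin d → ℝ | c j ≤ ∑ i, w j i * z i})
    (ystar : J → Fin d → ℝ)
    (hstar1 : ∀ j : J, c j ≤ (1 + ε) * ∑ i, w j i * ystar j i)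
    (hstar2 : ∀ j : J, ∀ y ∈ Y, (∑ i, w j i * ystar j i) ≤ α * ∑ i, w j i * y i) :
    ∀ y ∈ Y, (α * (1 + ε)) • y ∈ convexHull ℝ V + {z : Fin d → ℝ | 0 ≤ z} ∧
      ∃ v ∈ convexHull ℝ V, v ≤ (α * (1 + ε)) • y := by
  intro y hy
  have hmem : (α * (1 + ε)) • y ∈ convexHull ℝ V + {z : Fin d → ℝ | 0 ≤ z} := by
    rw [hH]
    refine Set.mem_iInter.2 fun j => ?_
    calc c j ≤ (1 + ε) * ∑ i, w j i * ystar j i := hstar1 j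
      _ ≤ (1 + ε) * (α * ∑ i, w j i * y i) :=
        mul_le_mul_of_nonneg_left (hstar2 j y hy) (by linarith)
      _ = ∑ i, w j i * ((α * (1 + ε)) • y) i := by
        simp only [Pi.smul_apply, smul_eq_mul, Finset.mul_sum]
        exact Finset.sum_congr rfl fun i _ => by ring
  refine ⟨hmem, ?_⟩
  obtain ⟨v, hv, z, hz, hvz⟩ := Set.mem_add.1 hmem
  exact ⟨v, hv, hvz ▸ le_add_of_nonneg_right hz⟩
end

section
/- Let d ≥ 1, ε > 0, and let LB, UB be reals with 0 < LB < UB. Set κ := max{k ∈ ℕ : LB·(1+ε)^k < UB} (this maximum exists since LB < UB). Then for every y ∈ ℝ^d such that each coordinate y_i is either equal to 0 or satisfies LB ≤ y_i ≤ UB, there exists s ∈ ℝ^d such that each coordinate s_i is either 0 (exactly when y_i = 0) or of the form LB·(1+ε)^k for some natural number k ≤ κ, and such that s ≤ y ≤ (1+ε)s componentwise. Equivalently, y lies in the hyperrectangle rect(s, (1+ε)s) for some grid point s of the grid 𝒮. -/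
/-- A point between the first and the last member of a sequence lies between two consecutive
members. -/
theorem exists_le_and_le_succ {α : Type*} [LinearOrder α] (a : ℕ → α) {x : α} (h0 : a 0 ≤ x)
    (n : ℕ) (hn : x ≤ a (n + 1)) : ∃ k ≤ n, a k ≤ x ∧ x ≤ a (k + 1) := by
  induction n with
  | zero => exact ⟨0, le_rfl, h0, hn⟩
  | succ n ih =>
    rcases le_total x (a (n + 1)) with h | h
    · obtain ⟨k, hk, hkx⟩ := ih h
      exact ⟨k, hk.trans n.le_succ, hkx⟩
    · exact ⟨n + 1, le_rfl, h, hn⟩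

/-- Covering property of the grid of Papadimitriou and Yannakakis: every point
whose coordinates are `0` or lie in `[LB, UB]` is contained in a grid hyperrectangle
`rect(s, (1+ε)s)` with `s_i = 0` exactly when `y_i = 0` and otherwise
`s_i = LB·(1+ε)^k` for some `k ≤ κ`. -/
theorem stmt_10 (d : ℕ) (hd : 1 ≤ d) (ε : ℝ) (hε : 0 < ε)
    (LB UB : ℝ) (hLB : 0 < LB) (hLBUB : LB < UB)
    (κ : ℕ) (hκ : IsGreatest {k : ℕ | LB * (1 + ε) ^ k < UB} κ) :
    ∀ y : Fin d → ℝ, (∀ i, y i = 0 ∨ (LB ≤ y i ∧ y i ≤ UB)) →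
      ∃ s : Fin d → ℝ,
        (∀ i, (y i = 0 ∧ s i = 0) ∨
          (y i ≠ 0 ∧ ∃ k : ℕ, k ≤ κ ∧ s i = LB * (1 + ε) ^ k)) ∧
        s ≤ y ∧ y ≤ (1 + ε) • s := by
  intro y hy
  have hUB : UB ≤ LB * (1 + ε) ^ (κ + 1) := by
    by_contra! h
    exact κ.not_succ_le_self (hκ.2 h)
  have hcoord : ∀ i, ∃ t : ℝ, ((y i = 0 ∧ t = 0) ∨
      (y i ≠ 0 ∧ ∃ k : ℕ, k ≤ κ ∧ t = LB * (1 + ε) ^ k)) ∧ t ≤ y i ∧ y i ≤ (1 + ε) * t := by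
    intro i
    rcases hy i with h | ⟨hl, hu⟩
    · exact ⟨0, Or.inl ⟨h, rfl⟩, h.ge, by simp [h]⟩
    · obtain ⟨k, hk, hky, hyk⟩ := exists_le_and_le_succ (fun k ↦ LB * (1 + ε) ^ k)
        (by simpa using hl) κ (hu.trans hUB)
      exact ⟨_, Or.inr ⟨(hLB.trans_le hl).ne', k, hk, rfl⟩, hky, hyk.trans_eq (by ring)⟩
  choose s hs hsy hys using hcoord
  exact ⟨s, hs, hsy, hys⟩
end
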